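/- arXiv:2405.12828 — 2 statements merged into one kernel-verified Lean document; each statement's English description precedes it below -/
import Mathlib

section
/- Let ω be a (p,q) double form on an n-dimensional Euclidean space with p + q ≤ n and k such that p + q + k ≥ n + 1. If gᵏ·ω = 0 then cʳω = 0 where r = p + q + k − n and c is the contraction map of double forms. -/
noncomputable section

open Finset
open scoped RealInnerProductSpace

/-- Euclidean `n`-space. -/
abbrev Evec (n : ℕ) := EuclideanSpace ℝ (Fin n)

/-- The space of `(p,q)` double forms, modeled as real-valued kernels on pairs of tuples. -/
abbrev DF (n p q : ℕ) := (Fin p → Evec n) → (Fin q → Evec n) → ℝ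

/-- `p`-forms. -/
abbrev Form (n p : ℕ) := (Fin p → Evec n) → ℝ

/-- Mixed-degree forms (elements of the full exterior algebra). -/
abbrev MixedForm (n : ℕ) := ∀ p, Form n p

/-- Mixed-bidegree double forms. -/
abbrev MixedDF (n : ℕ) := ∀ p q, DF n p q

/-- The standard orthonormal basis. -/
def ebasis (n : ℕ) (i : Fin n) : Evec n := EuclideanSpace.single i 1

/-- The metric as a `(1,1)` double form. -/
def gdf (n : ℕ) : DF n 1 1 := fun x y => ⟪x 0, y 0⟫

/-- Alternating multilinear predicate for a `p`-form kernel. -/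
def IsAltML {n m : ℕ} (f : Form n m) : Prop :=
  (∀ (x : Fin m → Evec n) (i : Fin m) (c : ℝ) (a b : Evec n),
      f (Function.update x i (c • a + b)) =
        c * f (Function.update x i a) + f (Function.update x i b)) ∧
  (∀ (x : Fin m → Evec n) (i j : Fin m), i ≠ j → x i = x j → f x = 0)

/-- A kernel is a genuine double form iff it is alternating multilinear in both blocks. -/
def IsDF {n p q : ℕ} (ω : DF n p q) : Prop :=
  (∀ y, IsAltML (n := n) fun x => ω x y) ∧ (∀ x, IsAltML (ω x))

/-- Bilinearity of a function of two vectors. -/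
def IsBilin {n : ℕ} (h : Evec n → Evec n → ℝ) : Prop :=
  (∀ y, IsLinearMap ℝ fun x => h x y) ∧ (∀ x, IsLinearMap ℝ (h x))

/-- A 2-form: an alternating bilinear function. -/
def IsAltBilin {n : ℕ} (h : Evec n → Evec n → ℝ) : Prop :=
  IsBilin h ∧ ∀ x, h x x = 0

/-- Exterior product of double forms. -/
def wedge {n p q r s : ℕ} (ω : DF n p q) (η : DF n r s) : DF n (p + r) (q + s) :=
  fun x y =>
    (((p.factorial * r.factorial * q.factorial * s.factorial : ℕ) : ℝ))⁻¹ *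
      ∑ σ : Equiv.Perm (Fin (p + r)), ∑ τ : Equiv.Perm (Fin (q + s)),
        ((Equiv.Perm.sign σ : ℤ) : ℝ) * ((Equiv.Perm.sign τ : ℤ) : ℝ) *
          ω (fun i => x (σ (Fin.castAdd r i))) (fun j => y (τ (Fin.castAdd s j))) *
          η (fun i => x (σ (Fin.natAdd p i))) (fun j => y (τ (Fin.natAdd q j)))

/-- Exterior powers of the metric: `gᵖ`. -/
def gpow (n : ℕ) : (p : ℕ) → DF n p p
  | 0 => fun _ _ => 1
  | p + 1 => wedge (gpow n p) (gdf n)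

/-- The natural inner product of `(p,q)` double forms. -/
def innerDF {n p q : ℕ} (ω η : DF n p q) : ℝ :=
  (((p.factorial * q.factorial : ℕ) : ℝ))⁻¹ *
    ∑ f : Fin p → Fin n, ∑ h : Fin q → Fin n,
      ω (fun i => ebasis n (f i)) (fun j => ebasis n (h j)) *
        η (fun i => ebasis n (f i)) (fun j => ebasis n (h j))

/-- Composition product of double forms: `comp ω₁ ω₂ = ω₁ ∘ ω₂`. -/
def comp {n p q r : ℕ} (ω₁ : DF n p q) (ω₂ : DF n r p) : DF n r q :=
  fun x y =>
    ((p.factorial : ℝ))⁻¹ *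
      ∑ f : Fin p → Fin n,
        ω₂ x (fun i => ebasis n (f i)) * ω₁ (fun i => ebasis n (f i)) y

/-- Transpose of a double form. -/
def transp {n p q : ℕ} (ω : DF n p q) : DF n q p := fun x y => ω y x

/-- Inclusion of bilinear forms as `(1,1)` double forms (the map `ρ`). -/
def rho {n : ℕ} (h : Evec n → Evec n → ℝ) : DF n 1 1 := fun x y => h (x 0) (y 0)

/-- Inner product of 2-forms. -/
def inner2 {n : ℕ} (α β : Evec n → Evec n → ℝ) : ℝ :=
  (2:ℝ)⁻¹ * ∑ i, ∑ j, α (ebasis n i) (ebasis n j) * β (ebasis n i) (ebasis n j)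

/-- The curvature operator of a `(2,2)` double form, acting on 2-forms. -/
def curvOp {n : ℕ} (R : DF n 2 2) (θ : Evec n → Evec n → ℝ) : Evec n → Evec n → ℝ :=
  fun x y => (2:ℝ)⁻¹ * ∑ i, ∑ j,
    θ (ebasis n i) (ebasis n j) * R ![ebasis n i, ebasis n j] ![x, y]

/-- The first Bianchi identity for a `(2,2)` double form. -/
def FirstBianchi {n : ℕ} (R : DF n 2 2) : Prop :=
  ∀ x y z t : Evec n, R ![x, y] ![z, t] + R ![y, z] ![x, t] + R ![z, x] ![y, t] = 0

/-- The Ricci contraction `c R` of a `(2,2)` double form. -/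
def ricci {n : ℕ} (R : DF n 2 2) : DF n 1 1 :=
  fun x y => ∑ i, R ![ebasis n i, x 0] ![ebasis n i, y 0]

/-- Contraction of double forms. -/
def contr {n p q : ℕ} (ω : DF n (p + 1) (q + 1)) : DF n p q :=
  fun x y => ∑ i, ω (Fin.cons (ebasis n i) x) (Fin.cons (ebasis n i) y)

/-- Iterated contraction `cʳ`. -/
def contrIter {n : ℕ} : (r : ℕ) → {p q : ℕ} → DF n (p + r) (q + r) → DF n p q
  | 0, _, _, ω => ω
  | r + 1, _, _, ω => contrIter r (contr ω)

/-- The `(1,1)` double form associated to an endomorphism. -/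
def hdf {n : ℕ} (h : Evec n →ₗ[ℝ] Evec n) : DF n 1 1 := fun x y => ⟪h (x 0), y 0⟫

/-- Left exterior multiplication of a form by a covector `f`. -/
def wedgeC {n p : ℕ} (f : Evec n → ℝ) (α : Form n p) : Form n (p + 1) :=
  fun x => ∑ i : Fin (p + 1), (-1 : ℝ) ^ (i : ℕ) * f (x i) * α (x ∘ i.succAbove)

/-- Interior product of a form by a vector. -/
def iotaV {n : ℕ} : {p : ℕ} → Evec n → Form n p → Form n (p - 1)
  | 0, _, _ => 0
  | _ + 1, v, α => fun x => α (Fin.cons v x)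


/-- Interior product (non-truncating version). -/
def iotaV' {n p : ℕ} (v : Evec n) (α : Form n (p + 1)) : Form n p :=
  fun x => α (Fin.cons v x)

/-- Interior product in the first block (non-truncating version). -/
def iotaL' {n p q : ℕ} (v : Evec n) (ω : DF n (p + 1) q) : DF n p q :=
  fun x y => ω (Fin.cons v x) y

/-- Interior product in the second block (non-truncating version). -/
def iotaR' {n p q : ℕ} (v : Evec n) (ω : DF n p (q + 1)) : DF n p q :=
  fun x y => ω x (Fin.cons v y)

/-- Embedding a homogeneous form into mixed forms. -/
def embF {n : ℕ} (p : ℕ) (α : Form n p) : MixedForm n :=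
  fun d => if h : d = p then cast (show Form n p = Form n d by rw [h]) α else 0

/-- Left Clifford multiplication `v · α` of a homogeneous form. -/
def cliffLone {n p : ℕ} (v : Evec n) (α : Form n p) : MixedForm n :=
  embF (p + 1) (wedgeC (fun u => ⟪v, u⟫) α) - embF (p - 1) (iotaV v α)

/-- Right Clifford multiplication `α · v` of a homogeneous form. -/
def cliffRone {n p : ℕ} (v : Evec n) (α : Form n p) : MixedForm n :=
  (-1 : ℝ) ^ p • (embF (p + 1) (wedgeC (fun u => ⟪v, u⟫) α) + embF (p - 1) (iotaV v α))

/-- Left Clifford multiplication by a vector on mixed forms. -/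
def cliffLv {n : ℕ} (v : Evec n) (ω : MixedForm n) : MixedForm n :=
  fun d => match d with
  | 0 => -(iotaV' v (ω 1))
  | d + 1 => wedgeC (fun u => ⟪v, u⟫) (ω d) - iotaV' v (ω (d + 1 + 1))

/-- Right Clifford multiplication by a vector on mixed forms. -/
def cliffRv {n : ℕ} (v : Evec n) (ω : MixedForm n) : MixedForm n :=
  fun d => match d with
  | 0 => -(iotaV' v (ω 1))
  | d + 1 => (-1 : ℝ) ^ d • (wedgeC (fun u => ⟪v, u⟫) (ω d) + iotaV' v (ω (d + 1 + 1)))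

/-- Left Clifford multiplication by a 2-form on mixed forms. -/
def cliffL2 {n : ℕ} (α : Evec n → Evec n → ℝ) (ω : MixedForm n) : MixedForm n :=
  (2:ℝ)⁻¹ • ∑ i, ∑ j, α (ebasis n i) (ebasis n j) • cliffLv (ebasis n i) (cliffLv (ebasis n j) ω)

/-- Right Clifford multiplication by a 2-form on mixed forms. -/
def cliffR2 {n : ℕ} (α : Evec n → Evec n → ℝ) (ω : MixedForm n) : MixedForm n :=
  (2:ℝ)⁻¹ • ∑ i, ∑ j, α (ebasis n i) (ebasis n j) • cliffRv (ebasis n j) (cliffRv (ebasis n i) ω)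

/-- Interior product by a vector in the first block of a double form. -/
def iotaL {n : ℕ} : {p q : ℕ} → Evec n → DF n p q → DF n (p - 1) q
  | 0, _, _, _ => 0
  | _ + 1, _, v, ω => fun x y => ω (Fin.cons v x) y

/-- Interior product by a vector in the second block of a double form. -/
def iotaR {n : ℕ} : {p q : ℕ} → Evec n → DF n p q → DF n p (q - 1)
  | _, 0, _, _ => 0
  | _, _ + 1, v, ω => fun x y => ω x (Fin.cons v y)

/-- Exterior multiplication by a covector in the first block. -/
def wedgeCL {n p q : ℕ} (f : Evec n → ℝ) (ω : DF n p q) : DF n (p + 1) q :=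
  fun x y => ∑ i : Fin (p + 1), (-1 : ℝ) ^ (i : ℕ) * f (x i) * ω (x ∘ i.succAbove) y

/-- Exterior multiplication by a covector in the second block. -/
def wedgeCR {n p q : ℕ} (f : Evec n → ℝ) (ω : DF n p q) : DF n p (q + 1) :=
  fun x y => ∑ j : Fin (q + 1), (-1 : ℝ) ^ (j : ℕ) * f (y j) * ω x (y ∘ j.succAbove)

/-- Left Clifford multiplication by a vector on the first factor of mixed double forms. -/
def cliffLvL {n : ℕ} (v : Evec n) (Ω : MixedDF n) : MixedDF n :=
  fun p q => match p with
  | 0 => -(iotaL' v (Ω 1 q))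
  | p + 1 => wedgeCL (fun u => ⟪v, u⟫) (Ω p q) - iotaL' v (Ω (p + 1 + 1) q)

/-- Right Clifford multiplication by a vector on the first factor of mixed double forms. -/
def cliffRvL {n : ℕ} (v : Evec n) (Ω : MixedDF n) : MixedDF n :=
  fun p q => match p with
  | 0 => -(iotaL' v (Ω 1 q))
  | p + 1 => (-1 : ℝ) ^ p • (wedgeCL (fun u => ⟪v, u⟫) (Ω p q) + iotaL' v (Ω (p + 1 + 1) q))

/-- Left Clifford multiplication by a vector on the second factor of mixed double forms. -/
def cliffLvR {n : ℕ} (v : Evec n) (Ω : MixedDF n) : MixedDF n :=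
  fun p q => match q with
  | 0 => -(iotaR' v (Ω p 1))
  | q + 1 => wedgeCR (fun u => ⟪v, u⟫) (Ω p q) - iotaR' v (Ω p (q + 1 + 1))

/-- Right Clifford multiplication by a vector on the second factor of mixed double forms. -/
def cliffRvR {n : ℕ} (v : Evec n) (Ω : MixedDF n) : MixedDF n :=
  fun p q => match q with
  | 0 => -(iotaR' v (Ω p 1))
  | q + 1 => (-1 : ℝ) ^ q • (wedgeCR (fun u => ⟪v, u⟫) (Ω p q) + iotaR' v (Ω p (q + 1 + 1)))

/-- Clifford commutator with a covector (1-form) on the first factor. -/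
def adLone {n : ℕ} (v : Evec n) (Ω : MixedDF n) : MixedDF n :=
  cliffLvL v Ω - cliffRvL v Ω

/-- Clifford commutator with a covector (1-form) on the second factor. -/
def adRone {n : ℕ} (v : Evec n) (Ω : MixedDF n) : MixedDF n :=
  cliffLvR v Ω - cliffRvR v Ω

/-- The sharp product of a `(1,1)` double form with a mixed double form. -/
def sharp11 {n : ℕ} (h : Evec n → Evec n → ℝ) (Ω : MixedDF n) : MixedDF n :=
  ∑ i, ∑ j, h (ebasis n i) (ebasis n j) • adLone (ebasis n i) (adRone (ebasis n j) Ω)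

/-- Clifford commutator with the 2-form `v ∧ w` (for orthonormal `v, w`) on the first factor. -/
def adLpair {n : ℕ} (v w : Evec n) (Ω : MixedDF n) : MixedDF n :=
  cliffLvL v (cliffLvL w Ω) - cliffRvL w (cliffRvL v Ω)

/-- Clifford commutator with the 2-form `v ∧ w` (for orthonormal `v, w`) on the second factor. -/
def adRpair {n : ℕ} (v w : Evec n) (Ω : MixedDF n) : MixedDF n :=
  cliffLvR v (cliffLvR w Ω) - cliffRvR w (cliffRvR v Ω)

/-- Clifford commutator with a 2-form on the first factor. -/
def adL2 {n : ℕ} (α : Evec n → Evec n → ℝ) (Ω : MixedDF n) : MixedDF n :=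
  (2:ℝ)⁻¹ • ∑ i, ∑ j, α (ebasis n i) (ebasis n j) • adLpair (ebasis n i) (ebasis n j) Ω

/-- Clifford commutator with a 2-form on the second factor. -/
def adR2 {n : ℕ} (α : Evec n → Evec n → ℝ) (Ω : MixedDF n) : MixedDF n :=
  (2:ℝ)⁻¹ • ∑ i, ∑ j, α (ebasis n i) (ebasis n j) • adRpair (ebasis n i) (ebasis n j) Ω

/-- The sharp product of a `(2,2)` double form with a mixed double form. -/
def sharpR {n : ℕ} (R : DF n 2 2) (Ω : MixedDF n) : MixedDF n :=
  (4:ℝ)⁻¹ • ∑ i, ∑ j, ∑ k, ∑ l,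
    R ![ebasis n i, ebasis n j] ![ebasis n k, ebasis n l] •
      adLpair (ebasis n i) (ebasis n j) (adRpair (ebasis n k) (ebasis n l) Ω)

/-- Embedding of a homogeneous double form into mixed double forms. -/
def embDF {n : ℕ} (p q : ℕ) (ω : DF n p q) : MixedDF n :=
  fun p' q' =>
    if h : p' = p ∧ q' = q then cast (show DF n p q = DF n p' q' by rw [h.1, h.2]) ω else 0

/-- Interior product of a double form by a `(1,1)` double form. -/
def iotaH {n : ℕ} : {p q : ℕ} → (Evec n → Evec n → ℝ) → DF n p q → DF n (p - 1) (q - 1)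
  | 0, _, _, _ => 0
  | _ + 1, 0, _, _ => 0
  | _ + 1, _ + 1, h, ω => fun x y =>
      ∑ i, ∑ j, h (ebasis n i) (ebasis n j) *
        ω (Fin.cons (ebasis n i) x) (Fin.cons (ebasis n j) y)

/-- Contraction of a double form, defined in every bidegree. -/
def contrAny {n : ℕ} : {p q : ℕ} → DF n p q → DF n (p - 1) (q - 1)
  | 0, _, _ => 0
  | _ + 1, 0, _ => 0
  | _ + 1, _ + 1, ω => fun x y =>
      ∑ i, ω (Fin.cons (ebasis n i) x) (Fin.cons (ebasis n i) y)

/-- The first Bianchi sum `𝔖`. -/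
def bianchiT {n : ℕ} : {p q : ℕ} → DF n p q → DF n (p + 1) (q - 1)
  | _, 0, _ => 0
  | p, _ + 1, ω => fun x y =>
      ∑ i, ∑ a : Fin (p + 1), (-1 : ℝ) ^ (a : ℕ) * ⟪ebasis n i, x a⟫ *
        ω (x ∘ a.succAbove) (Fin.cons (ebasis n i) y)

/-- The adjoint first Bianchi sum `𝔖̃`. -/
def bianchiAdjT {n : ℕ} : {p q : ℕ} → DF n p q → DF n (p - 1) (q + 1)
  | 0, _, _ => 0
  | _ + 1, q, ω => fun x y =>
      ∑ i, ∑ b : Fin (q + 1), (-1 : ℝ) ^ (b : ℕ) * ⟪ebasis n i, y b⟫ *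
        ω (Fin.cons (ebasis n i) x) (y ∘ b.succAbove)

/-- `g^{q-1} ρ(α) / (q-1)!`, the derivation extension of a `(1,1)` double form, with the
convention that it vanishes for `q = 0` (i.e. `g⁻¹ = 0`). -/
def gPowRho {n : ℕ} : (q : ℕ) → (Evec n → Evec n → ℝ) → DF n q q
  | 0, _ => 0
  | q + 1, α => ((q.factorial : ℝ))⁻¹ • wedge (gpow n q) (rho α)

/-- A 2-form is expressible in terms of `m` covectors. -/
def ExprBy {n : ℕ} (E : Evec n → Evec n → ℝ) (m : ℕ) : Prop :=
  ∃ (w : Fin m → Evec n) (c : Fin m → Fin m → ℝ), ∀ x y,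
    E x y = ∑ a, ∑ b, c a b * (⟪w a, x⟫ * ⟪w b, y⟫ - ⟪w a, y⟫ * ⟪w b, x⟫)

def toAlt9 {n m : ℕ} (α : Form n m) (h : IsAltML α) : AlternatingMap ℝ (Evec n) ℝ (Fin m) where
  toFun := α
  map_update_add' := by
    intro inst x i a b
    have e : inst = instDecidableEqFin m := Subsingleton.elim _ _
    subst e
    simpa using h.1 x i 1 a b
  map_update_smul' := by
    intro inst x i c a
    have e : inst = instDecidableEqFin m := Subsingleton.elim _ _
    subst e
    have h0 : α (Function.update x i 0) = 0 := by
      have := h.1 x i 1 0 0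
      simp only [smul_zero, add_zero, one_mul] at this
      linarith
    simpa [h0] using h.1 x i c a 0
  map_eq_zero_of_eq' := fun v i j hv hij => h.2 v i j hij hv

theorem toAlt9_apply {n m : ℕ} (α : Form n m) (h : IsAltML α) (x : Fin m → Evec n) :
    toAlt9 α h x = α x := rfl

theorem isAltML_alt9 {n m : ℕ} (f : AlternatingMap ℝ (Evec n) ℝ (Fin m)) :
    IsAltML (n := n) (fun x => f x) :=
  ⟨fun x i c a b => by simp, fun x i j hij hx => f.map_eq_zero_of_eq x hx hij⟩

theorem isAltML_wedgeC9 {n m : ℕ} (f : Evec n →ₗ[ℝ] ℝ) (α : Form n m) (h : IsAltML α) :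
    IsAltML (wedgeC (fun u => f u) α) := by
  have := isAltML_alt9 (AlternatingMap.alternatizeUncurryFin (f.smulRight (toAlt9 α h)))
  convert this using 2 with x
  simp only [wedgeC, AlternatingMap.alternatizeUncurryFin_apply, LinearMap.smulRight_apply,
    AlternatingMap.smul_apply, toAlt9_apply, smul_eq_mul, zsmul_eq_mul]
  push_cast
  simp only [mul_assoc]
  rfl

theorem isAltML_sum9 {n m : ℕ} {ι : Type*} (s : Finset ι) (c : ι → ℝ) (F : ι → Form n m)
    (h : ∀ i ∈ s, IsAltML (F i)) : IsAltML (n := n) (fun x => ∑ i ∈ s, c i * F i x) := by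
  constructor
  · intro x i r a b
    rw [Finset.mul_sum, ← Finset.sum_add_distrib]
    refine Finset.sum_congr rfl fun j hj => ?_
    rw [(h j hj).1 x i r a b]; ring
  · intro x i j hij hx
    exact Finset.sum_eq_zero fun l hl => by rw [(h l hl).2 x i j hij hx, mul_zero]

/-- Multiplication by the metric, expanded. -/
def G9 {n p q : ℕ} (ω : DF n p q) : DF n (p + 1) (q + 1) :=
  fun x y => ∑ i : Fin (p + 1), ∑ j : Fin (q + 1),
    (-1 : ℝ) ^ (i : ℕ) * (-1 : ℝ) ^ (j : ℕ) * ⟪x i, y j⟫ *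
      ω (fun a => x (i.succAbove a)) (fun b => y (j.succAbove b))

theorem isDF_G9 {n p q : ℕ} (ω : DF n p q) (h : IsDF ω) : IsDF (G9 ω) := by
  constructor
  · intro y
    have := isAltML_sum9 (n := n) (Finset.univ : Finset (Fin (q + 1)))
      (fun j => (-1 : ℝ) ^ (j : ℕ))
      (fun j => wedgeC (fun u => ((innerSL ℝ (y j)).toLinearMap) u)
        (fun x => ω x (fun b => y (j.succAbove b))))
      (fun j _ => isAltML_wedgeC9 _ _ (h.1 _))
    convert this using 2 with x
    simp only [G9, wedgeC, Finset.mul_sum]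
    rw [Finset.sum_comm]
    refine Finset.sum_congr rfl fun j _ => Finset.sum_congr rfl fun i _ => ?_
    simp only [ContinuousLinearMap.coe_coe, innerSL_apply_apply]
    rw [real_inner_comm (y j)]
    simp only [Function.comp_def]
    ring
  · intro x
    have := isAltML_sum9 (n := n) (Finset.univ : Finset (Fin (p + 1)))
      (fun j => (-1 : ℝ) ^ (j : ℕ))
      (fun j => wedgeC (fun u => ((innerSL ℝ (x j)).toLinearMap) u)
        (fun y => ω (fun b => x (j.succAbove b)) y))
      (fun j _ => isAltML_wedgeC9 _ _ (h.2 _))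
    convert this using 2 with y
    simp only [G9, wedgeC, Finset.mul_sum]
    refine Finset.sum_congr rfl fun j _ => Finset.sum_congr rfl fun i _ => ?_
    simp only [ContinuousLinearMap.coe_coe, innerSL_apply_apply]
    simp only [Function.comp_def]
    ring

theorem cons_succ9 {n q : ℕ} (e : Evec n) (y : Fin (q + 1) → Evec n) (j : Fin (q + 1)) :
    (fun b => (Fin.cons e y : Fin (q + 2) → Evec n) (j.succ.succAbove b))
      = Fin.cons e (fun b => y (j.succAbove b)) := by
  funext b
  refine Fin.cases ?_ (fun b => ?_) b
  · simp
  · simp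

theorem ebasis_eq9 {n : ℕ} (i : Fin n) : ebasis n i = EuclideanSpace.basisFun (Fin n) ℝ i := by
  simp [ebasis]

theorem euler9 {n q : ℕ} (α : Form n q) (h : IsAltML α) (y : Fin q → Evec n) (j : Fin q) :
    ∑ e, ⟪ebasis n e, y j⟫ *
      α (fun b => (Fin.cons (ebasis n e) y : Fin (q + 1) → Evec n) (j.succ.succAbove b))
      = (-1 : ℝ) ^ (j : ℕ) * α y := by
  cases q with
  | zero => exact j.elim0
  | succ q =>
    simp only [cons_succ9]
    have h1 : ∀ v : Evec n, α (Fin.cons v (fun b => y (j.succAbove b)))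
        = (toAlt9 α h).curryLeft v (fun b => y (j.succAbove b)) := fun v => rfl
    have h2 : y j = ∑ e, ⟪ebasis n e, y j⟫ • ebasis n e := by
      simp only [ebasis_eq9]
      exact ((EuclideanSpace.basisFun (Fin n) ℝ).sum_repr' (y j)).symm
    have h3 : α (Fin.cons (y j) (fun b => y (j.succAbove b))) = (-1 : ℝ) ^ (j : ℕ) * α y := by
      have h4 := Fin.cons_removeNth_eq_comp_cycleRange_symm y j
      have h5 := (toAlt9 α h).map_perm y j.cycleRange.symm
      rw [← h4] at h5
      simp only [toAlt9_apply] at h5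
      refine Eq.trans h5 ?_
      simp [Units.smul_def, Equiv.Perm.sign_symm]
    rw [← h3, h1]
    conv_rhs => rw [h2]
    have h6 : ∀ v : Evec n, (toAlt9 α h).curryLeft v (fun b => y (j.succAbove b))
        = (toAlt9 α h).toMultilinearMap.toLinearMap
            (Fin.cons 0 (fun b => y (j.succAbove b))) 0 v := by
      intro v
      simp only [MultilinearMap.toLinearMap_apply, Fin.update_cons_zero]
      rfl
    rw [h6, map_sum]
    refine Finset.sum_congr rfl fun e _ => ?_
    rw [map_smul, ← h6, h1, smul_eq_mul]

theorem comm_aux9 {n p q : ℕ} (ω : DF n p q) (h : IsDF ω) (x : Fin p → Evec n)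
    (y : Fin q → Evec n) :
    contr (G9 ω) x y = ((n : ℝ) - p - q) * ω x y +
      ∑ i : Fin p, ∑ j : Fin q, (-1 : ℝ) ^ (i : ℕ) * (-1 : ℝ) ^ (j : ℕ) * ⟪x i, y j⟫ *
        ∑ e, ω (fun b => (Fin.cons (ebasis n e) x : Fin (p + 1) → Evec n) (i.succ.succAbove b))
          (fun b => (Fin.cons (ebasis n e) y : Fin (q + 1) → Evec n) (j.succ.succAbove b)) := by
  have hs : ∀ j : ℕ, (-1 : ℝ) ^ j * (-1 : ℝ) ^ j = 1 := fun j => by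
    rw [← mul_pow]; simp
  have hee : ∀ e, ⟪ebasis n e, ebasis n e⟫ = (1 : ℝ) := fun e => by simp [ebasis]
  have A : ∑ e, ∑ j : Fin q, (-1 : ℝ) ^ (j : ℕ) * (⟪ebasis n e, y j⟫ *
      ω x (fun b => (Fin.cons (ebasis n e) y : Fin (q + 1) → Evec n) (j.succ.succAbove b)))
      = q * ω x y := by
    rw [Finset.sum_comm]
    have : ∀ j : Fin q, ∑ e, (-1 : ℝ) ^ (j : ℕ) * (⟪ebasis n e, y j⟫ *
        ω x (fun b => (Fin.cons (ebasis n e) y : Fin (q + 1) → Evec n) (j.succ.succAbove b)))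
        = ω x y := by
      intro j
      rw [← Finset.mul_sum, euler9 (ω x) (h.2 x) y, ← mul_assoc, hs, one_mul]
    simp only [this]
    simp
  have B : ∑ e, ∑ j : Fin p, (-1 : ℝ) ^ (j : ℕ) * (⟪ebasis n e, x j⟫ *
      ω (fun b => (Fin.cons (ebasis n e) x : Fin (p + 1) → Evec n) (j.succ.succAbove b)) y)
      = p * ω x y := by
    rw [Finset.sum_comm]
    have : ∀ j : Fin p, ∑ e, (-1 : ℝ) ^ (j : ℕ) * (⟪ebasis n e, x j⟫ *
        ω (fun b => (Fin.cons (ebasis n e) x : Fin (p + 1) → Evec n) (j.succ.succAbove b)) y)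
        = ω x y := by
      intro j
      rw [← Finset.mul_sum, euler9 (fun x => ω x y) (h.1 y) x, ← mul_assoc, hs, one_mul]
    simp only [this]
    simp
  have C : ∑ i : Fin p, ∑ j : Fin q, (-1 : ℝ) ^ (i : ℕ) * (-1 : ℝ) ^ (j : ℕ) * ⟪x i, y j⟫ *
        ∑ e, ω (fun b => (Fin.cons (ebasis n e) x : Fin (p + 1) → Evec n) (i.succ.succAbove b))
          (fun b => (Fin.cons (ebasis n e) y : Fin (q + 1) → Evec n) (j.succ.succAbove b))
      = ∑ e, ∑ i : Fin p, ∑ j : Fin q, (-1 : ℝ) ^ (i : ℕ) * (-1 : ℝ) ^ (j : ℕ) * ⟪x i, y j⟫ *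
         ω (fun b => (Fin.cons (ebasis n e) x : Fin (p + 1) → Evec n) (i.succ.succAbove b))
          (fun b => (Fin.cons (ebasis n e) y : Fin (q + 1) → Evec n) (j.succ.succAbove b)) := by
    simp only [Finset.mul_sum]
    conv_rhs => rw [Finset.sum_comm]
    exact Finset.sum_congr rfl fun i _ => Finset.sum_comm
  rw [C]
  have D : ((n : ℝ) - p - q) * ω x y = ∑ e : Fin n, ω x y
      - (∑ e, ∑ j : Fin p, (-1 : ℝ) ^ (j : ℕ) * (⟪ebasis n e, x j⟫ *
      ω (fun b => (Fin.cons (ebasis n e) x : Fin (p + 1) → Evec n) (j.succ.succAbove b)) y))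
      - ∑ e, ∑ j : Fin q, (-1 : ℝ) ^ (j : ℕ) * (⟪ebasis n e, y j⟫ *
      ω x (fun b => (Fin.cons (ebasis n e) y : Fin (q + 1) → Evec n) (j.succ.succAbove b))) := by
    rw [A, B]; simp; ring
  rw [D, ← Finset.sum_sub_distrib, ← Finset.sum_sub_distrib, ← Finset.sum_add_distrib]
  simp only [contr, G9]
  refine Finset.sum_congr rfl fun e _ => ?_
  simp only [Fin.sum_univ_succ (n := p), Fin.sum_univ_succ (n := q), Fin.cons_zero, Fin.cons_succ,
    Fin.val_zero, pow_zero, one_mul, mul_one, hee, Fin.zero_succAbove, Fin.val_succ,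
    Finset.sum_add_distrib, pow_succ, mul_neg, neg_mul, neg_neg, Finset.sum_neg_distrib]
  simp only [real_inner_comm (ebasis n e), mul_assoc]
  ring

theorem comm9 {n p q : ℕ} (ω : DF n (p + 1) (q + 1)) (h : IsDF ω) :
    contr (G9 ω) = ((n : ℝ) - (p + 1) - (q + 1)) • ω + G9 (contr ω) := by
  funext x y
  rw [comm_aux9 ω h]
  simp only [cons_succ9]
  simp [G9, contr]

theorem comm_left9 {n q : ℕ} (ω : DF n 0 q) (h : IsDF ω) :
    contr (G9 ω) = ((n : ℝ) - q) • ω := by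
  funext x y
  rw [comm_aux9 ω h]
  simp

theorem comm_right9 {n p : ℕ} (ω : DF n p 0) (h : IsDF ω) :
    contr (G9 ω) = ((n : ℝ) - p) • ω := by
  funext x y
  rw [comm_aux9 ω h]
  simp

theorem isDF_contr9 {n p q : ℕ} (ω : DF n (p + 1) (q + 1)) (h : IsDF ω) : IsDF (contr ω) := by
  constructor
  · intro y
    have := isAltML_sum9 (n := n) (m := p) Finset.univ (fun _ : Fin n => 1)
      (fun e x => ω (Fin.cons (ebasis n e) x) (Fin.cons (ebasis n e) y))
      (fun e _ => isAltML_alt9 ((toAlt9 _ (h.1 _)).curryLeft (ebasis n e)))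
    simpa [contr] using this
  · intro x
    have := isAltML_sum9 (n := n) (m := q) Finset.univ (fun _ : Fin n => 1)
      (fun e y => ω (Fin.cons (ebasis n e) x) (Fin.cons (ebasis n e) y))
      (fun e _ => isAltML_alt9 ((toAlt9 _ (h.2 _)).curryLeft (ebasis n e)))
    simp only [one_mul] at this
    exact this

theorem G9_zero {n p q : ℕ} : G9 (0 : DF n p q) = 0 := by
  funext x y; simp [G9]

theorem G9_comb {n p q : ℕ} (a : ℝ) (ω η : DF n p q) : G9 (a • ω + η) = a • G9 ω + G9 η := by
  funext x y
  simp only [G9, Pi.add_apply, Pi.smul_apply, smul_eq_mul, Finset.mul_sum,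
    ← Finset.sum_add_distrib]
  refine Finset.sum_congr rfl fun j _ => Finset.sum_congr rfl fun i _ => ?_
  ring

theorem contr_zero9 {n p q : ℕ} : contr (0 : DF n (p + 1) (q + 1)) = 0 := by
  funext x y; simp [contr]

/-- `gᵏ ω = 0`, iteratively. -/
def Kill9 {n : ℕ} : (k : ℕ) → {p q : ℕ} → DF n p q → Prop
  | 0, _, _, ω => ω = 0
  | k + 1, _, _, ω => Kill9 k (G9 ω)

theorem kill_comb9 {n : ℕ} (k : ℕ) : ∀ {p q : ℕ} (a : ℝ) (ω η : DF n p q), Kill9 k ω → Kill9 k η →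
    Kill9 k (a • ω + η) := by
  induction k with
  | zero => intro p q a ω η h1 h2; simp only [Kill9] at *; subst h1 h2; simp
  | succ k ih =>
    intro p q a ω η h1 h2
    simp only [Kill9] at *
    rw [G9_comb]
    exact ih a _ _ h1 h2

theorem kill_G9 {n : ℕ} (k : ℕ) : ∀ {p q : ℕ} (ω : DF n p q), Kill9 k ω → Kill9 k (G9 ω) := by
  induction k with
  | zero => intro p q ω h; simp only [Kill9] at *; subst h; exact G9_zero
  | succ k ih => intro p q ω h; exact ih _ h

theorem kill_contr9 {n : ℕ} (k : ℕ) : ∀ {p q : ℕ} (ω : DF n (p + 1) (q + 1)), IsDF ω →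
    Kill9 k ω → Kill9 (k + 1) (contr ω) := by
  induction k with
  | zero =>
    intro p q ω h hk
    simp only [Kill9] at *
    subst hk
    rw [contr_zero9, G9_zero]
  | succ k ih =>
    intro p q ω h hk
    have e : G9 (contr ω) = (-((n : ℝ) - (p + 1) - (q + 1))) • ω + contr (G9 ω) := by
      rw [comm9 ω h]; module
    show Kill9 (k + 1) (G9 (contr ω))
    rw [e]
    exact kill_comb9 _ _ _ _ hk (ih _ (isDF_G9 _ h) hk)

theorem prim9 {n : ℕ} (t : ℕ) : ∀ (j : ℕ) {p q : ℕ} (ω : DF n p q), IsDF ω →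
    contr (G9 ω) = (((j : ℝ) + 1) * t) • ω → (n : ℝ) - p - q = (t : ℝ) - j →
    Kill9 t ω → ω = 0 := by
  induction t with
  | zero => intro j p q ω h _ _ hk; exact hk
  | succ t ih =>
    intro j p q ω h hc hw hk
    have hG : G9 ω = 0 := by
      refine ih (j + 1) (G9 ω) (isDF_G9 _ h) ?_ ?_ hk
      · rw [comm9 _ (isDF_G9 _ h), hc]
        have := G9_comb (((j : ℝ) + 1) * ((t + 1 : ℕ) : ℝ)) ω 0
        rw [G9_zero, add_zero, add_zero] at this
        rw [this, ← add_smul]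
        congr 1
        push_cast at *
        linear_combination hw
      · push_cast at *
        linear_combination hw
    rw [hG, contr_zero9] at hc
    have : (((j : ℝ) + 1) * ((t + 1 : ℕ) : ℝ)) ≠ 0 := by positivity
    exact (smul_eq_zero.mp hc.symm).resolve_left this

theorem base9 {n : ℕ} (p : ℕ) : ∀ (q k : ℕ) (ω : DF n p q), IsDF ω → n = p + q + k →
    Kill9 k ω → ω = 0 := by
  induction p with
  | zero =>
    intro q k ω h hn hk
    have hn' : (n : ℝ) = q + k := by rw [hn]; push_cast; ring
    refine prim9 k 0 ω h ?_ ?_ hk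
    · rw [comm_left9 ω h, hn']; congr 1; push_cast; ring
    · rw [hn']; push_cast; ring
  | succ p ih =>
    intro q k ω h hn hk
    have hn' : (n : ℝ) = p + 1 + q + k := by rw [hn]; push_cast; ring
    cases q with
    | zero =>
      refine prim9 k 0 ω h ?_ ?_ hk
      · rw [comm_right9 ω h, hn']; congr 1; push_cast; ring
      · rw [hn']; push_cast; ring
    | succ q =>
      have hc : contr ω = 0 :=
        ih q (k + 2) (contr ω) (isDF_contr9 ω h) (by omega)
          (kill_contr9 (k + 1) ω h (kill_G9 k ω hk))
      refine prim9 k 0 ω h ?_ ?_ hk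
      · rw [comm9 ω h, hc, G9_zero, add_zero, hn']; congr 1; push_cast; ring
      · rw [hn']; push_cast; ring

theorem main9 {n : ℕ} (r : ℕ) : ∀ (p q k : ℕ) (ω : DF n (p + r) (q + r)), IsDF ω →
    n = p + q + r + k → Kill9 k ω → contrIter r ω = 0 := by
  induction r with
  | zero => intro p q k ω h hn hk; exact base9 _ _ k ω h (by omega) hk
  | succ r ih =>
    intro p q k ω h hn hk
    exact ih p q (k + 1) (contr ω) (isDF_contr9 (p := p + r) (q := q + r) ω h) (by omega)
      (kill_contr9 (p := p + r) (q := q + r) k ω h hk)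

/-- Full antisymmetrization in both blocks. -/
def A9 {n N M : ℕ} (T : DF n N M) : DF n N M := fun x y =>
  ∑ σ : Equiv.Perm (Fin N), ∑ τ : Equiv.Perm (Fin M),
    ((Equiv.Perm.sign σ : ℤ) : ℝ) * ((Equiv.Perm.sign τ : ℤ) : ℝ) *
      T (fun i => x (σ i)) (fun j => y (τ j))

theorem sgn_sq9 {N : ℕ} (σ : Equiv.Perm (Fin N)) :
    ((Equiv.Perm.sign σ : ℤ) : ℝ) * ((Equiv.Perm.sign σ : ℤ) : ℝ) = 1 := by
  rcases Int.units_eq_one_or (Equiv.Perm.sign σ) with h | h <;> simp [h]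

theorem A9_perm {n N M : ℕ} (T : DF n N M) (ρ : Equiv.Perm (Fin N)) (ρ' : Equiv.Perm (Fin M))
    (x : Fin N → Evec n) (y : Fin M → Evec n) :
    A9 (fun x y => T (fun i => x (ρ i)) (fun j => y (ρ' j))) x y =
      ((Equiv.Perm.sign ρ : ℤ) : ℝ) * ((Equiv.Perm.sign ρ' : ℤ) : ℝ) * A9 T x y := by
  simp only [A9]
  conv_rhs => rw [← Equiv.sum_comp (Equiv.mulRight ρ)]
  rw [Finset.mul_sum]
  refine Finset.sum_congr rfl fun σ _ => ?_
  conv_rhs => rw [← Equiv.sum_comp (Equiv.mulRight ρ')]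
  rw [Finset.mul_sum]
  refine Finset.sum_congr rfl fun τ _ => ?_
  simp only [Equiv.coe_mulRight, Equiv.Perm.sign_mul, Units.val_mul, Int.cast_mul,
    Equiv.Perm.mul_apply]
  have h1 := sgn_sq9 ρ
  have h2 := sgn_sq9 ρ'
  generalize T _ _ = t
  generalize ((Equiv.Perm.sign ρ : ℤ) : ℝ) = a at *
  generalize ((Equiv.Perm.sign ρ' : ℤ) : ℝ) = b at *
  generalize ((Equiv.Perm.sign σ : ℤ) : ℝ) = c
  generalize ((Equiv.Perm.sign τ : ℤ) : ℝ) = d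
  linear_combination (-c * d * t * b * b) * h1 - c * d * t * h2

theorem A9_sum {n N M : ℕ} {ι : Type*} (s : Finset ι) (c : ι → ℝ) (T : ι → DF n N M)
    (x : Fin N → Evec n) (y : Fin M → Evec n) :
    A9 (fun x y => ∑ a ∈ s, c a * T a x y) x y = ∑ a ∈ s, c a * A9 (T a) x y := by
  simp only [A9, Finset.mul_sum]
  rw [Finset.sum_comm]
  simp_rw [Finset.sum_comm (s := s)]
  rw [Finset.sum_comm]
  refine Finset.sum_congr rfl fun σ _ => Finset.sum_congr rfl fun τ _ =>
    Finset.sum_congr rfl fun a _ => ?_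
  ring

/-- If `S` is a signed average of permuted copies of `T`, antisymmetrizations are proportional. -/
theorem A9_avg {n N M : ℕ} {ι κ : Type*} [Fintype ι] [Fintype κ] (c : ℝ)
    (ρ : ι → Equiv.Perm (Fin N)) (ρ' : κ → Equiv.Perm (Fin M)) (S T : DF n N M)
    (h : ∀ x y, S x y = c * ∑ a, ∑ b, ((Equiv.Perm.sign (ρ a) : ℤ) : ℝ) *
      ((Equiv.Perm.sign (ρ' b) : ℤ) : ℝ) *
        T (fun i => x (ρ a i)) (fun j => y (ρ' b j)))
    (x : Fin N → Evec n) (y : Fin M → Evec n) :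
    A9 S x y = c * (Fintype.card ι * Fintype.card κ) * A9 T x y := by
  have hS : S = fun x y => ∑ ab ∈ (Finset.univ : Finset (ι × κ)),
      (c * (((Equiv.Perm.sign (ρ ab.1) : ℤ) : ℝ) * ((Equiv.Perm.sign (ρ' ab.2) : ℤ) : ℝ))) *
        (fun x y => T (fun i => x (ρ ab.1 i)) (fun j => y (ρ' ab.2 j)) : DF n N M) x y := by
    funext x y
    rw [h, Fintype.sum_prod_type]
    simp only [Finset.mul_sum, mul_assoc]
  rw [hS, A9_sum Finset.univ
    (fun ab : ι × κ => c * (((Equiv.Perm.sign (ρ ab.1) : ℤ) : ℝ) *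
      ((Equiv.Perm.sign (ρ' ab.2) : ℤ) : ℝ)))
    (fun ab : ι × κ => (fun x y => T (fun i => x (ρ ab.1 i)) (fun j => y (ρ' ab.2 j)) :
      DF n N M))]
  have : ∀ ab : ι × κ, c * (((Equiv.Perm.sign (ρ ab.1) : ℤ) : ℝ) *
      ((Equiv.Perm.sign (ρ' ab.2) : ℤ) : ℝ)) *
      A9 (fun x y => T (fun i => x (ρ ab.1 i)) (fun j => y (ρ' ab.2 j)) : DF n N M) x y
      = c * A9 T x y := by
    intro ab
    rw [A9_perm]
    have h1 := sgn_sq9 (ρ ab.1)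
    have h2 := sgn_sq9 (ρ' ab.2)
    generalize A9 T x y = t
    generalize ((Equiv.Perm.sign (ρ ab.1) : ℤ) : ℝ) = a at *
    generalize ((Equiv.Perm.sign (ρ' ab.2) : ℤ) : ℝ) = b at *
    linear_combination (c * t * b * b) * h1 + c * t * h2
  simp only [this]
  simp
  ring

theorem A9_cast {n N M N' M' : ℕ} (h : N = N') (h' : M = M') (T : DF n N M) (S : DF n N' M')
    (hS : ∀ x y, S x y = T (fun i => x (Fin.cast h i)) (fun j => y (Fin.cast h' j)))
    (h0 : A9 T = 0) : A9 S = 0 := by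
  subst h h'
  have : S = T := by funext x y; exact hS x y
  rw [this, h0]

/-- Extend permutations of a block. -/
def ext9 {a b : ℕ} (σ : Equiv.Perm (Fin a)) (τ : Equiv.Perm (Fin b)) :
    Equiv.Perm (Fin (a + b)) := finSumFinEquiv.permCongr (Equiv.Perm.sumCongr σ τ)

theorem ext9_left {a b : ℕ} (σ : Equiv.Perm (Fin a)) (τ : Equiv.Perm (Fin b)) (i : Fin a) :
    ext9 σ τ (Fin.castAdd b i) = Fin.castAdd b (σ i) := by
  simp [ext9, Equiv.permCongr_apply]

theorem ext9_right {a b : ℕ} (σ : Equiv.Perm (Fin a)) (τ : Equiv.Perm (Fin b)) (i : Fin b) :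
    ext9 σ τ (Fin.natAdd a i) = Fin.natAdd a (τ i) := by
  simp [ext9, Equiv.permCongr_apply]

theorem ext9_sign {a b : ℕ} (σ : Equiv.Perm (Fin a)) (τ : Equiv.Perm (Fin b)) :
    Equiv.Perm.sign (ext9 σ τ) = Equiv.Perm.sign σ * Equiv.Perm.sign τ := by
  simp [ext9]

theorem wedge_eq9 {n p q r s : ℕ} (ω : DF n p q) (η : DF n r s) (x : Fin (p + r) → Evec n)
    (y : Fin (q + s) → Evec n) :
    wedge ω η x y = (((p.factorial * r.factorial * q.factorial * s.factorial : ℕ) : ℝ))⁻¹ *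
      A9 (fun x y => ω (fun i => x (Fin.castAdd r i)) (fun j => y (Fin.castAdd s j)) *
        η (fun i => x (Fin.natAdd p i)) (fun j => y (Fin.natAdd q j))) x y := by
  simp only [wedge, A9, mul_assoc]

theorem wedge_iff9 {n p q r s : ℕ} (ω : DF n p q) (η : DF n r s) :
    wedge ω η = 0 ↔
      A9 (fun x y => ω (fun i => x (Fin.castAdd r i)) (fun j => y (Fin.castAdd s j)) *
        η (fun i => x (Fin.natAdd p i)) (fun j => y (Fin.natAdd q j)) :
          DF n (p + r) (q + s)) = 0 := by
  have hc : ((((p.factorial * r.factorial * q.factorial * s.factorial : ℕ) : ℝ))⁻¹) ≠ 0 := by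
    have := p.factorial_ne_zero
    have := q.factorial_ne_zero
    have := r.factorial_ne_zero
    have := s.factorial_ne_zero
    apply inv_ne_zero
    exact_mod_cast (by simp [*])
  constructor
  · intro h
    funext x y
    have := congrFun (congrFun h x) y
    rw [wedge_eq9] at this
    exact (mul_eq_zero.mp this).resolve_left hc
  · intro h
    funext x y
    rw [wedge_eq9, h]
    simp

theorem step9 {n k p q : ℕ} (ω : DF n p q) (h : wedge (gpow n (k + 1)) ω = 0) :
    wedge (gpow n k) (G9 ω) = 0 := by
  rw [wedge_iff9] at *
  have hT2 : A9 (fun x y => gpow n k (fun i => x (Fin.castAdd p (Fin.castAdd 1 i)))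
      (fun j => y (Fin.castAdd q (Fin.castAdd 1 j))) *
      (⟪x (Fin.castAdd p (Fin.natAdd k 0)), y (Fin.castAdd q (Fin.natAdd k 0))⟫ *
      ω (fun i => x (Fin.natAdd (k + 1) i)) (fun j => y (Fin.natAdd (k + 1) j))) :
      DF n (k + 1 + p) (k + 1 + q)) = 0 := by
    funext x y
    have h' := congrFun (congrFun h x) y
    rw [A9_avg (((k.factorial * Nat.factorial 1 * k.factorial * Nat.factorial 1 : ℕ) : ℝ))⁻¹
      (fun σ : Equiv.Perm (Fin (k + 1)) => ext9 σ (1 : Equiv.Perm (Fin p)))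
      (fun σ : Equiv.Perm (Fin (k + 1)) => ext9 σ (1 : Equiv.Perm (Fin q))) _
      (fun x y => gpow n k (fun i => x (Fin.castAdd p (Fin.castAdd 1 i)))
        (fun j => y (Fin.castAdd q (Fin.castAdd 1 j))) *
        (⟪x (Fin.castAdd p (Fin.natAdd k 0)), y (Fin.castAdd q (Fin.natAdd k 0))⟫ *
        ω (fun i => x (Fin.natAdd (k + 1) i)) (fun j => y (Fin.natAdd (k + 1) j))))] at h'
    · refine (mul_eq_zero.mp h').resolve_left ?_
      have := k.factorial_ne_zero
      have h1 : Fintype.card (Equiv.Perm (Fin (k + 1))) ≠ 0 := Fintype.card_ne_zero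
      refine mul_ne_zero (inv_ne_zero ?_) (mul_ne_zero ?_ ?_)
      · exact_mod_cast (by simp [*])
      · exact_mod_cast h1
      · exact_mod_cast h1
    · intro x y
      simp only [gpow, wedge, ext9_left, ext9_right, ext9_sign, gdf]
      rw [mul_assoc, Finset.sum_mul]
      congr 1
      refine Finset.sum_congr rfl fun σ _ => ?_
      rw [Finset.sum_mul]
      refine Finset.sum_congr rfl fun τ _ => ?_
      simp
      ring
  have hT4 : A9 (fun x y => gpow n k (fun i => x (Fin.castAdd (p + 1) i))
      (fun j => y (Fin.castAdd (q + 1) j)) *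
      (⟪x (Fin.natAdd k 0), y (Fin.natAdd k 0)⟫ *
      ω (fun i => x (Fin.natAdd k i.succ)) (fun j => y (Fin.natAdd k j.succ))) :
      DF n (k + (p + 1)) (k + (q + 1))) = 0 := by
    refine A9_cast (by omega) (by omega) _ _ ?_ hT2
    intro x y
    congr 1
    congr 2
    · funext i; congr 1; ext; simp; omega
    · funext i; congr 1; ext; simp; omega
  funext x y
  rw [A9_avg 1
      (fun a : Fin (p + 1) => ext9 (1 : Equiv.Perm (Fin k)) a.cycleRange.symm)
      (fun a : Fin (q + 1) => ext9 (1 : Equiv.Perm (Fin k)) a.cycleRange.symm) _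
      (fun x y => gpow n k (fun i => x (Fin.castAdd (p + 1) i))
      (fun j => y (Fin.castAdd (q + 1) j)) *
      (⟪x (Fin.natAdd k 0), y (Fin.natAdd k 0)⟫ *
      ω (fun i => x (Fin.natAdd k i.succ)) (fun j => y (Fin.natAdd k j.succ)))), hT4]
  · simp
  · intro x y
    simp only [G9, ext9_left, ext9_right, ext9_sign, Fin.cycleRange_symm_zero,
      Fin.cycleRange_symm_succ, one_mul, Finset.mul_sum]
    refine Finset.sum_congr rfl fun σ _ => Finset.sum_congr rfl fun τ _ => ?_
    simp [Equiv.Perm.sign_symm]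
    ring

theorem kill_of_wedge9 {n : ℕ} (k : ℕ) : ∀ {p q : ℕ} (ω : DF n p q), IsDF ω →
    wedge (gpow n k) ω = 0 → Kill9 k ω := by
  induction k with
  | zero =>
    intro p q ω hω h
    rw [wedge_iff9] at h
    show ω = 0
    have h' : A9 ω = 0 := by
      refine A9_cast (Nat.zero_add p) (Nat.zero_add q) _ _ ?_ h
      intro x y
      simp only [gpow, one_mul]
      congr 1
      · funext i; congr 1; ext; simp
      · funext i; congr 1; ext; simp
    funext x y
    have h2 := congrFun (congrFun h' x) y
    have h3 : ∀ (σ : Equiv.Perm (Fin p)) (τ : Equiv.Perm (Fin q)),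
        ((Equiv.Perm.sign σ : ℤ) : ℝ) * ((Equiv.Perm.sign τ : ℤ) : ℝ) *
          ω (fun i => x (σ i)) (fun j => y (τ j)) = ω x y := by
      intro σ τ
      have e1 : ω (fun i => x (σ i)) (fun j => y (τ j)) =
          ((Equiv.Perm.sign σ : ℤ) : ℝ) * ω x (fun j => y (τ j)) := by
        have := (toAlt9 _ (hω.1 (fun j => y (τ j)))).map_perm x σ
        simp only [Units.smul_def, zsmul_eq_mul] at this
        exact this
      have e2 : ω x (fun j => y (τ j)) = ((Equiv.Perm.sign τ : ℤ) : ℝ) * ω x y := by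
        have := (toAlt9 _ (hω.2 x)).map_perm y τ
        simp only [Units.smul_def, zsmul_eq_mul] at this
        exact this
      rw [e1, e2]
      have h1 := sgn_sq9 σ
      have h2 := sgn_sq9 τ
      generalize ω x y = t
      generalize ((Equiv.Perm.sign σ : ℤ) : ℝ) = a at *
      generalize ((Equiv.Perm.sign τ : ℤ) : ℝ) = b at *
      linear_combination (t * b * b) * h1 + t * h2
    simp only [A9, h3] at h2
    simpa [Fintype.card_perm, Nat.factorial_ne_zero] using h2
  | succ k ih =>
    intro p q ω hω h
    exact ih _ (isDF_G9 _ hω) (step9 ω h)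

/-- If `ω` is a `(p,q)` double form (here `p = p₀ + r`, `q = q₀ + r`) with
`p + q ≤ n` and `p + q + k ≥ n + 1`, and `r = p + q + k − n`, then `gᵏ · ω = 0` implies
`cʳ ω = 0`. -/
theorem statement9 (n p q r k : ℕ) (ω : DF n (p + r) (q + r)) (hω : IsDF ω)
    (h1 : (p + r) + (q + r) ≤ n) (h2 : n + 1 ≤ (p + r) + (q + r) + k)
    (hr : r = (p + r) + (q + r) + k - n)
    (h0 : wedge (gpow n k) ω = 0) : contrIter r ω = 0 := by

  exact main9 r p q k ω hω (by omega) (kill_of_wedge9 k ω hω h0)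
end
end

section
/- For a (2,2) double form R and a (p,q) double form ω on a Euclidean n-space with orthonormal basis (eᵢ), one has R # ω = 4 Σ_{j,k=1}^{n} (ι_{e_j⊗e_k} R)·(ι_{e_j⊗e_k} ω), where · is the exterior product of double forms and ι_{e_j⊗e_k}(θ₁⊗θ₂) = ι_{e_j}θ₁ ⊗ ι_{e_k}θ₂. -/
noncomputable section

open Finset
open scoped RealInnerProductSpace

/-- An alternating multilinear kernel as a Mathlib alternating map. -/
def IsAltML.toAlt {n m : ℕ} {f : Form n m} (hf : IsAltML f) :
    AlternatingMap ℝ (Evec n) ℝ (Fin m) where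
  toFun := f
  map_update_add' := by
    intro inst x i a b
    have h := hf.1 x i 1 a b
    rw [Subsingleton.elim inst (instDecidableEqFin m)]
    simpa using h
  map_update_smul' := by
    intro inst x i c a
    have h0 := hf.1 x i 1 0 0
    have h := hf.1 x i c a 0
    rw [Subsingleton.elim inst (instDecidableEqFin m)]
    simp at h0 h
    simp [h, h0]
  map_eq_zero_of_eq' := by
    intro x i j h hij
    exact hf.2 x i j hij h

theorem IsAltML.toAlt_apply {n m : ℕ} {f : Form n m} (hf : IsAltML f) (x : Fin m → Evec n) :
    hf.toAlt x = f x := rfl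

theorem IsAltML.cons_removeNth {n m : ℕ} {f : Form n (m + 1)} (hf : IsAltML f)
    (x : Fin (m + 1) → Evec n) (a : Fin (m + 1)) (v : Evec n) :
    (-1 : ℝ) ^ (a : ℕ) * f (Fin.cons v (x ∘ a.succAbove)) = f (Function.update x a v) := by
  have h := AlternatingMap.map_insertNth hf.toAlt a v (a.removeNth x)
  rw [Fin.insertNth_removeNth] at h
  simp only [IsAltML.toAlt_apply] at h
  rw [h]
  rcases neg_one_pow_eq_or ℤ (a : ℕ) with h1 | h1 <;>
  rcases neg_one_pow_eq_or ℝ (a : ℕ) with h2 | h2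
  · rw [h1, h2]; simp; rfl
  · exfalso
    have := congrArg (Int.cast : ℤ → ℝ) h1
    push_cast at this
    rw [h2] at this; norm_num at this
  · exfalso
    have := congrArg (Int.cast : ℤ → ℝ) h1
    push_cast at this
    rw [h2] at this; norm_num at this
  · rw [h1, h2]; simp; rfl

theorem wedgeC_wedgeC {n m : ℕ} (f g : Evec n → ℝ) (α : Form n m) (x : Fin (m + 1 + 1) → Evec n) :
    wedgeC f (wedgeC g α) x + wedgeC g (wedgeC f α) x = 0 := by
  unfold wedgeC
  simp only [Finset.mul_sum, ← Finset.sum_add_distrib]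
  rw [Fin.sum_sum_eq_sum_triangle_add]
  refine Finset.sum_eq_zero fun i _ => Finset.sum_eq_zero fun j hj => ?_
  rw [Finset.mem_Ici] at hj
  have H₁ : (x ∘ i.castSucc.succAbove) j = x j.succ := by
    simp [Fin.succAbove_of_le_castSucc, hj]
  have H₂ : (x ∘ j.succ.succAbove) i = x i.castSucc := by
    simp [Fin.succAbove_of_castSucc_lt, hj]
  have H₃ : (x ∘ i.castSucc.succAbove) ∘ j.succAbove = (x ∘ j.succ.succAbove) ∘ i.succAbove := by
    have := Fin.removeNth_removeNth_eq_swap x j i.castSucc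
    simp [Fin.predAbove, not_lt.2 hj, Fin.succAbove] at this
    exact this
  rw [H₁, H₂, H₃]
  simp only [Fin.val_castSucc, Fin.val_succ, pow_succ]
  ring

theorem wedgeC_iota {n m : ℕ} (f : Evec n → ℝ) (v : Evec n) {α : Form n (m + 1)}
    (hα : IsAltML α) (x : Fin (m + 1) → Evec n) :
    wedgeC f (iotaV' v α) x = ∑ a, f (x a) * α (Function.update x a v) := by
  unfold wedgeC iotaV'
  refine Finset.sum_congr rfl fun a _ => ?_
  rw [← hα.cons_removeNth]; ring

theorem iota_wedgeC {n m : ℕ} (f : Evec n → ℝ) (v : Evec n) {α : Form n m}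
    (hα : IsAltML α) (x : Fin m → Evec n) :
    iotaV' v (wedgeC f α) x = f v * α x - ∑ a, f (x a) * α (Function.update x a v) := by
  cases m with
  | zero => simp [wedgeC, iotaV']
  | succ m =>
    rw [← wedgeC_iota f v hα]
    simp only [wedgeC, iotaV']
    rw [Fin.sum_univ_succ (n := m + 1), sub_eq_add_neg, ← Finset.sum_neg_distrib]
    congr 1
    · simp
    · refine Finset.sum_congr rfl fun a _ => ?_
      have : (Fin.cons v x : Fin (m + 1 + 1) → Evec n) ∘ a.succ.succAbove
          = Fin.cons v (x ∘ a.succAbove) := by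
        ext b; refine Fin.cases ?_ (fun b => ?_) b <;> simp
      rw [this]
      simp [pow_succ]

theorem iota_iota {n m : ℕ} (v w : Evec n) {α : Form n (m + 1 + 1)}
    (hα : IsAltML α) (x : Fin m → Evec n) :
    iotaV' v (iotaV' w α) x + iotaV' w (iotaV' v α) x = 0 := by
  unfold iotaV'
  have h := hα.toAlt.map_swap (Fin.cons w (Fin.cons v x)) (i := 0) (j := 1) (by simp)
  simp only [IsAltML.toAlt_apply] at h
  have h2 : (Fin.cons w (Fin.cons v x) : Fin (m + 1 + 1) → Evec n) ∘ Equiv.swap 0 1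
      = Fin.cons v (Fin.cons w x) := by
    funext b
    refine Fin.cases ?_ (fun b => ?_) b
    · simp
    · refine Fin.cases ?_ (fun b => ?_) b
      · simp
      · simp only [Function.comp_apply, Fin.cons_succ]
        rw [Equiv.swap_apply_of_ne_of_ne]
        · simp
        · exact Fin.succ_ne_zero _
        · rw [← Fin.succ_zero_eq_one, Ne, Fin.succ_inj]; exact Fin.succ_ne_zero _
  rw [h2] at h
  rw [h]; simp

theorem wedgeC_add_smul {n m : ℕ} (f : Evec n → ℝ) (c : ℝ) (α β : Form n m) :
    wedgeC f (α + c • β) = wedgeC f α + c • wedgeC f β := by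
  funext x
  simp only [wedgeC, Pi.add_apply, Pi.smul_apply, smul_eq_mul, Finset.mul_sum,
    ← Finset.sum_add_distrib]
  refine Finset.sum_congr rfl fun a _ => ?_
  ring

theorem iota_add_smul {n m : ℕ} (v : Evec n) (c : ℝ) (α β : Form n (m + 1)) :
    iotaV' v (α + c • β) = iotaV' v α + c • iotaV' v β := rfl

theorem cliff_comm {n : ℕ} (v w : Evec n) (Φ : MixedForm n) (hΦ : ∀ d, IsAltML (Φ d))
    (d : ℕ) (x : Fin d → Evec n) :
    cliffLv v (cliffLv w Φ) d x - cliffRv w (cliffRv v Φ) d x =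
      2 * ((∑ a, ⟪w, x a⟫ * Φ d (Function.update x a v)) -
        ∑ a, ⟪v, x a⟫ * Φ d (Function.update x a w)) := by
  have e1 : ∀ {m : ℕ} (α β : Form n m), α - β = α + (-1 : ℝ) • β := by
    intro m α β; rw [neg_one_smul, sub_eq_add_neg]
  have e2 : ∀ {m : ℕ} (α : Form n m), -α = 0 + (-1 : ℝ) • α := by
    intro m α; rw [neg_one_smul, zero_add]
  have e3 : ∀ {m : ℕ} (c : ℝ) (α β : Form n m), c • (α + β) = (0 + c • α) + c • β := by
    intro m c α β; rw [smul_add, zero_add]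
  have w0 : ∀ {m : ℕ} (f : Evec n → ℝ), wedgeC f (0 : Form n m) = 0 := by
    intro m f; funext x; simp [wedgeC]
  have i0 : ∀ {m : ℕ} (v : Evec n), iotaV' v (0 : Form n (m+1)) = 0 := by
    intro m f; rfl
  have hc : ⟪v, w⟫ = ⟪w, v⟫ := real_inner_comm _ _
  match d, x with
  | 0, x =>
    have h2 := iota_iota v w (hΦ 2) x
    have h3 := iota_wedgeC (fun u => ⟪v, u⟫) w (hΦ 0) x
    have h4 := iota_wedgeC (fun u => ⟪w, u⟫) v (hΦ 0) x
    simp only [cliffLv, cliffRv, e1, e2, e3, wedgeC_add_smul, iota_add_smul, w0, i0,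
      Pi.add_apply, Pi.smul_apply, smul_eq_mul, Pi.zero_apply, h3, h4]
    simp [hc] at h2 ⊢
    linarith
  | 1, x =>
    have h2 := iota_iota v w (hΦ 3) x
    have h3 := iota_wedgeC (fun u => ⟪v, u⟫) w (hΦ 1) x
    have h4 := iota_wedgeC (fun u => ⟪w, u⟫) v (hΦ 1) x
    have h5 := wedgeC_iota (fun u => ⟪v, u⟫) w (hΦ 1) x
    have h6 := wedgeC_iota (fun u => ⟪w, u⟫) v (hΦ 1) x
    simp only [cliffLv, cliffRv, e1, e2, e3, wedgeC_add_smul, iota_add_smul, w0, i0,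
      Pi.add_apply, Pi.smul_apply, smul_eq_mul, Pi.zero_apply, h3, h4, h5, h6, hc]
    linear_combination h2
  | m + 2, x =>
    have h1 := wedgeC_wedgeC (fun u => ⟪v, u⟫) (fun u => ⟪w, u⟫) (Φ m) x
    have h2 := iota_iota v w (hΦ (m + 4)) x
    have h3 := iota_wedgeC (fun u => ⟪v, u⟫) w (hΦ (m + 2)) x
    have h4 := iota_wedgeC (fun u => ⟪w, u⟫) v (hΦ (m + 2)) x
    have h5 := wedgeC_iota (fun u => ⟪v, u⟫) w (hΦ (m + 2)) x
    have h6 := wedgeC_iota (fun u => ⟪w, u⟫) v (hΦ (m + 2)) x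
    have hs : ((-1 : ℝ) ^ m) * (-1 : ℝ) ^ m = 1 := by
      rw [← mul_pow]; simp
    simp only [cliffLv, cliffRv, e1, e2, e3, wedgeC_add_smul, iota_add_smul, w0, i0,
      Pi.add_apply, Pi.smul_apply, smul_eq_mul, Pi.zero_apply, h3, h4, h5, h6, hc, pow_succ]
    rcases neg_one_pow_eq_or ℝ m with h | h <;> rw [h] <;> linear_combination h1 + h2

theorem adLpair_eq {n : ℕ} (v w : Evec n) (Ω : MixedDF n)
    (hΩ : ∀ p q y, IsAltML (n := n) (fun x => Ω p q x y)) (p q : ℕ) (x : Fin p → Evec n)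
    (y : Fin q → Evec n) :
    adLpair v w Ω p q x y =
      2 * ((∑ a, ⟪w, x a⟫ * Ω p q (Function.update x a v) y) -
        ∑ a, ⟪v, x a⟫ * Ω p q (Function.update x a w) y) := by
  rw [← cliff_comm v w (fun p x => Ω p q x y) (fun d => hΩ d q y) p x]
  match p, x with
  | 0, x => rfl
  | 1, x => rfl
  | m + 2, x => rfl

theorem adRpair_eq {n : ℕ} (v w : Evec n) (Ω : MixedDF n)
    (hΩ : ∀ p q x, IsAltML (n := n) (Ω p q x)) (p q : ℕ) (x : Fin p → Evec n)
    (y : Fin q → Evec n) :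
    adRpair v w Ω p q x y =
      2 * ((∑ a, ⟪w, y a⟫ * Ω p q x (Function.update y a v)) -
        ∑ a, ⟪v, y a⟫ * Ω p q x (Function.update y a w)) := by
  rw [← cliff_comm v w (fun q => Ω p q x) (fun d => hΩ p d x) q y]
  match q, y with
  | 0, y => rfl
  | 1, y => rfl
  | m + 2, y => rfl

theorem adRpair_alt {n : ℕ} (v w : Evec n) (Ω : MixedDF n) (hΩ : ∀ p q, IsDF (Ω p q))
    (p q : ℕ) (y : Fin q → Evec n) : IsAltML (n := n) (fun x => adRpair v w Ω p q x y) := by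
  have H : ∀ p q x, IsAltML (n := n) (Ω p q x) := fun p q => (hΩ p q).2
  constructor
  · intro x i c a b
    simp only [adRpair_eq v w Ω H]
    simp only [fun z => ((hΩ p q).1 z).1 x i c a b, mul_add, Finset.sum_add_distrib]
    simp only [mul_left_comm _ c, ← Finset.mul_sum]
    ring
  · intro x i j hij h
    simp only [adRpair_eq v w Ω H]
    simp only [fun z => ((hΩ p q).1 z).2 x i j hij h]
    simp

theorem ebasis_expand {n : ℕ} (x : Evec n) : ∑ i, ⟪ebasis n i, x⟫ • ebasis n i = x := by
  have h := (EuclideanSpace.basisFun (Fin n) ℝ).sum_repr' x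
  simpa [ebasis] using h

/-- Contraction of an alternating kernel against the commutator formula. -/
theorem block {n m : ℕ} (S : Form n 2) (hS : IsAltML S) (φ : Form n m)
    (x : Fin m → Evec n) :
    ∑ i, ∑ j, S ![ebasis n i, ebasis n j] *
      (2 * ((∑ a, ⟪ebasis n j, x a⟫ * φ (Function.update x a (ebasis n i))) -
        ∑ a, ⟪ebasis n i, x a⟫ * φ (Function.update x a (ebasis n j)))) =
    4 * ∑ i, ∑ a, S ![ebasis n i, x a] * φ (Function.update x a (ebasis n i)) := by
  have hlin : ∀ v u : Evec n, S ![v, u] = ∑ j, S ![v, ebasis n j] * ⟪ebasis n j, u⟫ := by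
    intro v u
    have h1 : ∀ z, S ![v, z] = hS.toAlt.toMultilinearMap.toLinearMap ![v, v] 1 z := by
      intro z
      simp only [MultilinearMap.toLinearMap_apply]
      have : Function.update ![v, v] 1 z = ![v, z] := by
        funext b; fin_cases b <;> simp
      rw [this]; rfl
    conv_lhs => rw [← ebasis_expand u, h1, map_sum]
    refine Finset.sum_congr rfl fun j _ => ?_
    rw [map_smul, ← h1, smul_eq_mul, mul_comm]
  have hanti : ∀ u v : Evec n, S ![u, v] = - S ![v, u] := by
    intro u v
    have h := hS.toAlt.map_swap ![v, u] (i := 0) (j := 1) (by simp)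
    have h2 : ![v, u] ∘ Equiv.swap (0 : Fin 2) 1 = ![u, v] := by
      funext b; fin_cases b <;> simp
    rw [h2] at h
    exact h
  have key : ∑ i, ∑ j, S ![ebasis n i, ebasis n j] *
      (∑ a, ⟪ebasis n j, x a⟫ * φ (Function.update x a (ebasis n i))) =
      ∑ i, ∑ a, S ![ebasis n i, x a] * φ (Function.update x a (ebasis n i)) := by
    refine Finset.sum_congr rfl fun i _ => ?_
    simp only [Finset.mul_sum]
    rw [Finset.sum_comm]
    refine Finset.sum_congr rfl fun a _ => ?_
    rw [hlin _ (x a), Finset.sum_mul]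
    refine Finset.sum_congr rfl fun j _ => ?_
    ring
  have key2 : ∑ i, ∑ j, S ![ebasis n i, ebasis n j] *
      (∑ a, ⟪ebasis n i, x a⟫ * φ (Function.update x a (ebasis n j))) =
      - ∑ i, ∑ a, S ![ebasis n i, x a] * φ (Function.update x a (ebasis n i)) := by
    rw [← key, Finset.sum_comm, ← Finset.sum_neg_distrib]
    refine Finset.sum_congr rfl fun i _ => ?_
    rw [← Finset.sum_neg_distrib]
    refine Finset.sum_congr rfl fun j _ => ?_
    rw [hanti]; ring
  have : ∀ i j, S ![ebasis n i, ebasis n j] *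
      (2 * ((∑ a, ⟪ebasis n j, x a⟫ * φ (Function.update x a (ebasis n i))) -
        ∑ a, ⟪ebasis n i, x a⟫ * φ (Function.update x a (ebasis n j)))) =
      2 * (S ![ebasis n i, ebasis n j] *
        (∑ a, ⟪ebasis n j, x a⟫ * φ (Function.update x a (ebasis n i)))) -
      2 * (S ![ebasis n i, ebasis n j] *
        (∑ a, ⟪ebasis n i, x a⟫ * φ (Function.update x a (ebasis n j)))) := by
    intro i j; ring
  simp only [this, Finset.sum_sub_distrib, ← Finset.mul_sum]
  simp only [key, key2]
  ring

theorem sharpR_eq {n : ℕ} (R : DF n 2 2) (hR : IsDF R) (Ω : MixedDF n)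
    (hΩ : ∀ p q, IsDF (Ω p q)) (p q : ℕ) (x : Fin p → Evec n) (y : Fin q → Evec n) :
    sharpR R Ω p q x y = 4 * ∑ i, ∑ a, ∑ k, ∑ b,
      R ![ebasis n i, x a] ![ebasis n k, y b] *
        Ω p q (Function.update x a (ebasis n i)) (Function.update y b (ebasis n k)) := by
  have hL : ∀ v w p q y, IsAltML (n := n) (fun x => adRpair v w Ω p q x y) :=
    fun v w => adRpair_alt v w Ω hΩ
  have step1 : sharpR R Ω p q x y = 4⁻¹ * ∑ k, ∑ l, ∑ i, ∑ j,
      R ![ebasis n i, ebasis n j] ![ebasis n k, ebasis n l] *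
        adLpair (ebasis n i) (ebasis n j) (adRpair (ebasis n k) (ebasis n l) Ω) p q x y := by
    unfold sharpR
    simp only [Pi.smul_apply, Finset.sum_apply, smul_eq_mul]
    congr 1
    calc _ = ∑ i, ∑ k, ∑ j, ∑ l, R ![ebasis n i, ebasis n j] ![ebasis n k, ebasis n l] *
        adLpair (ebasis n i) (ebasis n j) (adRpair (ebasis n k) (ebasis n l) Ω) p q x y :=
          Finset.sum_congr rfl fun i _ => Finset.sum_comm
      _ = ∑ k, ∑ i, ∑ l, ∑ j, R ![ebasis n i, ebasis n j] ![ebasis n k, ebasis n l] *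
        adLpair (ebasis n i) (ebasis n j) (adRpair (ebasis n k) (ebasis n l) Ω) p q x y := by
          rw [Finset.sum_comm]
          exact Finset.sum_congr rfl fun k _ => Finset.sum_congr rfl fun i _ => Finset.sum_comm
      _ = _ := Finset.sum_congr rfl fun k _ => Finset.sum_comm
  rw [step1]
  have step2 : ∀ k l, ∑ i, ∑ j,
      R ![ebasis n i, ebasis n j] ![ebasis n k, ebasis n l] *
        adLpair (ebasis n i) (ebasis n j) (adRpair (ebasis n k) (ebasis n l) Ω) p q x y =
      4 * ∑ i, ∑ a, R ![ebasis n i, x a] ![ebasis n k, ebasis n l] *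
        adRpair (ebasis n k) (ebasis n l) Ω p q (Function.update x a (ebasis n i)) y := by
    intro k l
    rw [← block (fun z => R z ![ebasis n k, ebasis n l]) (hR.1 _)
      (fun x' => adRpair (ebasis n k) (ebasis n l) Ω p q x' y) x]
    refine Finset.sum_congr rfl fun i _ => Finset.sum_congr rfl fun j _ => ?_
    rw [adLpair_eq _ _ _ (hL _ _)]
  simp only [step2, ← Finset.mul_sum]
  have step3 : ∀ i a, ∑ k, ∑ l, R ![ebasis n i, x a] ![ebasis n k, ebasis n l] *
        adRpair (ebasis n k) (ebasis n l) Ω p q (Function.update x a (ebasis n i)) y =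
      4 * ∑ k, ∑ b, R ![ebasis n i, x a] ![ebasis n k, y b] *
        Ω p q (Function.update x a (ebasis n i)) (Function.update y b (ebasis n k)) := by
    intro i a
    rw [← block (R ![ebasis n i, x a]) (hR.2 _) (Ω p q (Function.update x a (ebasis n i))) y]
    refine Finset.sum_congr rfl fun k _ => Finset.sum_congr rfl fun l _ => ?_
    rw [adRpair_eq _ _ _ (fun p q => (hΩ p q).2)]
  have step4 : ∑ k, ∑ l, ∑ i, ∑ a, R ![ebasis n i, x a] ![ebasis n k, ebasis n l] *
        adRpair (ebasis n k) (ebasis n l) Ω p q (Function.update x a (ebasis n i)) y =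
      ∑ i, ∑ a, ∑ k, ∑ l, R ![ebasis n i, x a] ![ebasis n k, ebasis n l] *
        adRpair (ebasis n k) (ebasis n l) Ω p q (Function.update x a (ebasis n i)) y := by
    simp only [← Fintype.sum_prod_type' (f := fun (k l : Fin n) => ∑ i, ∑ a,
      R ![ebasis n i, x a] ![ebasis n k, ebasis n l] *
        adRpair (ebasis n k) (ebasis n l) Ω p q (Function.update x a (ebasis n i)) y)]
    rw [Finset.sum_comm]
    refine Finset.sum_congr rfl fun i _ => ?_
    rw [Finset.sum_comm]
    refine Finset.sum_congr rfl fun a _ => ?_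
    rw [Fintype.sum_prod_type]
  rw [step4]
  simp only [step3, ← Finset.mul_sum]
  ring

theorem embDF_apply {n p q p' q' : ℕ} (ω : DF n p q) (hp : p' = p) (hq : q' = q)
    (x : Fin p' → Evec n) (y : Fin q' → Evec n) :
    embDF p q ω p' q' x y = ω (x ∘ Fin.cast hp.symm) (y ∘ Fin.cast hq.symm) := by
  subst hp hq
  simp [embDF]

theorem embDF_ne {n p q p' q' : ℕ} (ω : DF n p q) (h : ¬ (p' = p ∧ q' = q)) :
    embDF p q ω p' q' = 0 := by
  simp [embDF, h]

theorem isDF_zero {n p q : ℕ} : IsDF (0 : DF n p q) := by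
  refine ⟨fun y => ⟨?_, ?_⟩, fun x => ⟨?_, ?_⟩⟩ <;> intros <;> simp

theorem embDF_isDF {n p q : ℕ} {ω : DF n p q} (hω : IsDF ω) (p' q' : ℕ) :
    IsDF (embDF p q ω p' q') := by
  by_cases h : p' = p ∧ q' = q
  · obtain ⟨rfl, rfl⟩ := h
    simpa [embDF] using hω
  · rw [embDF_ne ω h]; exact isDF_zero

theorem sum_perm {m : ℕ} (F : Fin (m + 1) → ℝ) :
    ∑ σ : Equiv.Perm (Fin (m + 1)), F (σ 0) = (m.factorial : ℝ) * ∑ a, F a := by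
  rw [← Equiv.sum_comp Equiv.Perm.decomposeFin.symm, Fintype.sum_prod_type]
  simp [Fintype.card_perm, Finset.mul_sum]

theorem wedge_block {n m : ℕ} (S : Evec n → ℝ) (v : Evec n) {φ : Form n (m + 1)}
    (hφ : IsAltML φ) (x : Fin (m + 1) → Evec n) (h : 1 + m = m + 1) :
    ∑ σ : Equiv.Perm (Fin (1 + m)), ((Equiv.Perm.sign σ : ℤ) : ℝ) *
      (S (x (Fin.cast h (σ (Fin.castAdd m 0)))) *
        φ (Fin.cons v (fun i => x (Fin.cast h (σ (Fin.natAdd 1 i)))))) =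
    (m.factorial : ℝ) * ∑ a, S (x a) * φ (Function.update x a v) := by
  rw [← sum_perm (fun a => S (x a) * φ (Function.update x a v))]
  rw [← Equiv.sum_comp (Equiv.permCongr (finCongr h))]
  refine Finset.sum_congr rfl fun σ _ => ?_
  have h0 : (finCongr h).symm 0 = Fin.castAdd m 0 := by ext; simp
  have hs : ∀ i : Fin m, (finCongr h).symm i.succ = Fin.natAdd 1 i := by
    intro i; ext; simp [add_comm]
  have e0 : (Equiv.permCongr (finCongr h)) σ 0 = Fin.cast h (σ (Fin.castAdd m 0)) := by
    rw [Equiv.permCongr_apply, h0]; rfl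
  have es : ∀ i : Fin m, (Equiv.permCongr (finCongr h)) σ i.succ
      = Fin.cast h (σ (Fin.natAdd 1 i)) := by
    intro i; rw [Equiv.permCongr_apply, hs]; rfl
  rw [← Equiv.Perm.sign_permCongr (finCongr h) σ]
  simp only [← e0, ← es]
  generalize (Equiv.permCongr (finCongr h)) σ = τ
  have hc : (Fin.cons v (fun i : Fin m => x (τ i.succ)) : Fin (m + 1) → Evec n) =
      Function.update x (τ 0) v ∘ τ := by
    funext b
    refine Fin.cases ?_ (fun b => ?_) b
    · simp
    · simp [Function.update_apply]
  have hp := hφ.toAlt.map_perm (Function.update x (τ 0) v) τ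
  rw [hc]
  simp only [IsAltML.toAlt_apply] at hp
  have hp' : φ (Function.update x (τ 0) v ∘ τ) =
      ((Equiv.Perm.sign τ : ℤ) : ℝ) * φ (Function.update x (τ 0) v) := by
    refine hp.trans ?_
    simp [Units.smul_def]
  rw [hp']
  rcases Int.units_eq_one_or (Equiv.Perm.sign τ) with h | h <;> rw [h] <;> simp

theorem wedge_eq {n m k : ℕ} (R : DF n 2 2) (ω : DF n (m + 1) (k + 1)) (hω : IsDF ω)
    (u v : Evec n) (x : Fin (m + 1) → Evec n) (y : Fin (k + 1) → Evec n)
    (hm : 1 + m = m + 1) (hk : 1 + k = k + 1) :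
    wedge (p := 1) (q := 1) (r := m) (s := k)
      (fun x' y' => R (Fin.cons u x') (Fin.cons v y'))
      (fun x' y' => ω (Fin.cons u x') (Fin.cons v y')) (x ∘ Fin.cast hm) (y ∘ Fin.cast hk) =
    ∑ a, ∑ b, R ![u, x a] ![v, y b] *
      ω (Function.update x a u) (Function.update y b v) := by
  have hc : ∀ (w : Evec n) (z : Fin 1 → Evec n),
      (Fin.cons w z : Fin 2 → Evec n) = ![w, z 0] := by
    intro w z; funext b; fin_cases b <;> rfl
  unfold wedge
  simp only [hc, Function.comp_apply]
  have s1 : ∀ σ : Equiv.Perm (Fin (1 + m)), ∑ τ : Equiv.Perm (Fin (1 + k)),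
      ((Equiv.Perm.sign σ : ℤ) : ℝ) * ((Equiv.Perm.sign τ : ℤ) : ℝ) *
        R ![u, x (Fin.cast hm (σ (Fin.castAdd m 0)))] ![v, y (Fin.cast hk (τ (Fin.castAdd k 0)))] *
        ω (Fin.cons u (fun i => x (Fin.cast hm (σ (Fin.natAdd 1 i)))))
          (Fin.cons v (fun i => y (Fin.cast hk (τ (Fin.natAdd 1 i))))) =
      (k.factorial : ℝ) * ∑ b, ((Equiv.Perm.sign σ : ℤ) : ℝ) *
        (R ![u, x (Fin.cast hm (σ (Fin.castAdd m 0)))] ![v, y b] *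
        ω (Fin.cons u (fun i => x (Fin.cast hm (σ (Fin.natAdd 1 i))))) (Function.update y b v)) := by
    intro σ
    rw [← Finset.mul_sum, mul_left_comm, ← wedge_block
      (fun z => R ![u, x (Fin.cast hm (σ (Fin.castAdd m 0)))] ![v, z]) v (hω.2 _) y hk,
      Finset.mul_sum]
    refine Finset.sum_congr rfl fun τ _ => ?_
    ring
  simp only [s1]
  rw [← Finset.mul_sum, Finset.sum_comm]
  have s2 := fun b => wedge_block (fun z => R ![u, z] ![v, y b]) u (hω.1 (Function.update y b v)) x hm
  simp only [s2]
  rw [← Finset.mul_sum, Finset.sum_comm]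
  have h1 := Nat.factorial_ne_zero m
  have h2 := Nat.factorial_ne_zero k
  simp
  field_simp

theorem wedge_zero_right {n p q r s : ℕ} (ω : DF n p q) : wedge ω (0 : DF n r s) = 0 := by
  funext x y; simp [wedge]

theorem embDF_zero {n p q : ℕ} : embDF p q (0 : DF n p q) = 0 := by
  funext p' q' x y
  by_cases h : p' = p ∧ q' = q
  · rw [embDF_apply _ h.1 h.2]; rfl
  · rw [embDF_ne _ h]; rfl

/-- For a `(2,2)` double form `R` and a `(p,q)` double form `ω`:
`R # ω = 4 ∑_{j,k} (ι_{e_j⊗e_k} R) · (ι_{e_j⊗e_k} ω)`. -/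
theorem statement16 (n p q : ℕ) (R : DF n 2 2) (hR : IsDF R)
    (ω : DF n p q) (hω : IsDF ω) :
    sharpR R (embDF p q ω) =
      embDF (1 + (p - 1)) (1 + (q - 1))
        ((4 : ℝ) • ∑ j, ∑ k,
          wedge (iotaL (ebasis n j) (iotaR (ebasis n k) R))
            (iotaL (ebasis n j) (iotaR (ebasis n k) ω))) := by
  funext p' q' x y
  rw [sharpR_eq R hR _ (embDF_isDF hω)]
  match p, q, ω, hω with
  | 0, q, ω, hω =>
    have h0 : ∀ j k, iotaL (ebasis n j) (iotaR (ebasis n k) ω) = 0 := fun j k => rfl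
    simp only [h0, wedge_zero_right, Finset.sum_const_zero, smul_zero, embDF_zero]
    by_cases h : p' = 0
    · subst h; simp
    · rw [embDF_ne ω (fun h' => h h'.1)]; simp
  | m + 1, 0, ω, hω =>
    have h0 : ∀ j k, iotaL (ebasis n j) (iotaR (ebasis n k) ω) = 0 := fun j k => rfl
    simp only [h0, wedge_zero_right, Finset.sum_const_zero, smul_zero, embDF_zero]
    by_cases h : q' = 0
    · subst h; simp
    · rw [embDF_ne ω (fun h' => h h'.2)]; simp
  | m + 1, k + 1, ω, hω =>
    by_cases h : p' = m + 1 ∧ q' = k + 1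
    · obtain ⟨rfl, rfl⟩ := h
      have hm : 1 + m = m + 1 := add_comm _ _
      have hk : 1 + k = k + 1 := add_comm _ _
      rw [embDF_apply _ (show m + 1 = 1 + (m + 1 - 1) from hm.symm)
        (show k + 1 = 1 + (k + 1 - 1) from hk.symm)]
      simp only [embDF_apply ω rfl rfl, Pi.smul_apply, Finset.sum_apply, smul_eq_mul]
      congr 1
      refine Finset.sum_congr rfl fun i _ => ?_
      rw [Finset.sum_comm]
      refine Finset.sum_congr rfl fun j _ => ?_
      exact (wedge_eq R ω hω (ebasis n i) (ebasis n j) x y hm hk).symm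
    · rw [embDF_ne ω h, embDF_ne]
      · simp
      · intro h'
        exact h ⟨by omega, by omega⟩
end
end
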